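/- For every natural number l ≥ 2, the Schmidt-rank width of the 2D cluster state C_{(2l+1)×(2l+1)} (the graph state of the (2l+1) × (2l+1) grid graph) is at least l − 1. In particular, the Schmidt-rank width is unbounded on the family of 2D cluster states. -/

import Mathlib

open scoped BigOperators Classical

noncomputable section

/-- The Schmidt rank `χ_{A,Aᶜ}(ψ)` of a state across the bipartition `(A, Aᶜ)`:
the rank over `ℂ` of the matrix indexed by `(u : A → Bool) × (v : Aᶜ → Bool)`
whose entries are the amplitudes of the strings agreeing with `u` on `A` and
with `v` on `Aᶜ`. -/
def schmidtRank {V : Type} [Fintype V] [DecidableEq V]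
    (ψ : (V → Bool) → ℂ) (A : Set V) : ℕ :=
  Matrix.rank (Matrix.of fun (u : ↥A → Bool) (v : ↥Aᶜ → Bool) =>
    ψ fun i => if h : i ∈ A then u ⟨i, h⟩ else v ⟨i, h⟩)

/-- The degree of a vertex: the number of its neighbors. -/
def deg {M : ℕ} (T : SimpleGraph (Fin M)) (v : Fin M) : ℕ :=
  (T.neighborSet v).ncard

/-- A subcubic tree: a finite tree in which every vertex has degree 1 or 3. -/
def IsSubcubicTree {M : ℕ} (T : SimpleGraph (Fin M)) : Prop :=
  T.IsTree ∧ ∀ v, deg T v = 1 ∨ deg T v = 3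

/-- The set of qubits (vertices) lying in the connected component of the endpoint
`w` of the deleted edge `e` of the tree `T`, transported to `V` along the leaf
labeling `ℓ`. -/
def leafSide {M : ℕ} (T : SimpleGraph (Fin M)) {V : Type}
    (ℓ : {v : Fin M // deg T v = 1} ≃ V) (e : Sym2 (Fin M)) (w : Fin M) : Set V :=
  {i : V | ∃ l : {v : Fin M // deg T v = 1},
      (T.deleteEdges {e}).Reachable w l.val ∧ ℓ l = i}

/-- The Schmidt-rank width `χ_wd(ψ)`: the minimum over all subcubic trees `T`
whose leaves are identified with the qubits of the maximum over the edges `e` of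
`T` of `log₂ χ_{A_T^e, B_T^e}(ψ)`, where `(A_T^e, B_T^e)` is the bipartition of
the qubits induced by deleting `e` from `T`. -/
def chiWidth {V : Type} [Fintype V] [DecidableEq V] (ψ : (V → Bool) → ℂ) : ℝ :=
  sInf { r : ℝ | ∃ (M : ℕ) (T : SimpleGraph (Fin M)), IsSubcubicTree T ∧
    ∃ ℓ : {v : Fin M // deg T v = 1} ≃ V,
      r = sSup { s : ℝ | ∃ e ∈ T.edgeSet, ∃ w, w ∈ e ∧
        s = Real.logb 2 (schmidtRank ψ (leafSide T ℓ e w)) } }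

/-- The number `q_G(x)` of edges `{a,b}` of `G` with `x a = x b = true`. -/
def qCount {V : Type} [Fintype V] [DecidableEq V] (G : SimpleGraph V)
    (x : V → Bool) : ℕ :=
  (Finset.univ.filter fun e : Sym2 V => e ∈ G.edgeSet ∧ ∀ v ∈ e, x v = true).card

/-- The graph state of a finite simple graph `G` on the vertex set `V`:
`|G⟩(x) = 2^{−n/2} · (−1)^{q_G(x)}` where `n = |V|`. -/
def graphState {V : Type} [Fintype V] [DecidableEq V] (G : SimpleGraph V) :
    (V → Bool) → ℂ :=
  fun x => (1 / (Real.sqrt (2 ^ Fintype.card V) : ℂ)) * (-1) ^ qCount G x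

/-- The `d × d` grid graph on `Fin d × Fin d`: two vertices are adjacent iff they
agree in one coordinate and differ by exactly `1` in the other. -/
def gridGraph (d : ℕ) : SimpleGraph (Fin d × Fin d) :=
  SimpleGraph.fromRel fun a b =>
    (a.1 = b.1 ∧ a.2.val + 1 = b.2.val) ∨ (a.2 = b.2 ∧ a.1.val + 1 = b.1.val)

/-- The 2D cluster state `C_{d×d}`: the graph state of the `d × d` grid graph. -/
def clusterState (d : ℕ) : ((Fin d × Fin d) → Bool) → ℂ :=
  graphState (gridGraph d)

/-- Deleting the edge `s(v, w)` from `G`, the component containing `w`. -/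
def branch {V : Type*} (G : SimpleGraph V) (v w : V) : Set V :=
  {x | (G.deleteEdges {s(v, w)}).Reachable w x}

theorem mem_branch_self {V : Type*} (G : SimpleGraph V) (v w : V) : w ∈ branch G v w :=
  SimpleGraph.Reachable.refl _

theorem branch_of_adj {V : Type*} {G : SimpleGraph V} {v w x y : V}
    (hx : x ∈ branch G v w) (hxy : G.Adj x y) (hne : s(x, y) ≠ s(v, w)) :
    y ∈ branch G v w := by
  have h : (G.deleteEdges {s(v, w)}).Adj x y := by
    simp only [SimpleGraph.deleteEdges_adj, Set.mem_singleton_iff]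
    exact ⟨hxy, hne⟩
  exact SimpleGraph.Reachable.trans hx h.reachable

/-- A set closed under adjacency contains everything reachable from its points. -/
theorem mem_of_reachable {V : Type*} {G : SimpleGraph V} {S : Set V} {w x : V}
    (hw : w ∈ S) (hS : ∀ a b, G.Reachable w a → a ∈ S → G.Adj a b → b ∈ S)
    (h : G.Reachable w x) : x ∈ S := by
  rw [SimpleGraph.reachable_iff_reflTransGen] at h
  induction h with
  | refl => exact hw
  | tail hab hbc ih =>
    exact hS _ _ ((SimpleGraph.reachable_iff_reflTransGen _ _).2 hab) ih hbc

theorem branch_union {V : Type*} {G : SimpleGraph V} (hG : G.Connected) (v w x : V) :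
    x ∈ branch G v w ∨ x ∈ branch G w v := by
  refine mem_of_reachable (S := {x | x ∈ branch G v w ∨ x ∈ branch G w v}) (w := w)
    (Or.inl (mem_branch_self G v w)) ?_ (hG.preconnected w x)
  rintro a b - ha hab
  by_cases h : s(a, b) = s(v, w)
  · rcases Sym2.eq_iff.1 h with ⟨-, rfl⟩ | ⟨-, rfl⟩
    · exact Or.inl (mem_branch_self G _ _)
    · exact Or.inr (mem_branch_self G _ _)
  · rcases ha with ha | ha
    · exact Or.inl (branch_of_adj ha hab h)
    · exact Or.inr (branch_of_adj ha hab (by rwa [Sym2.eq_swap (a := w)]))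

theorem mem_branch_cases {V : Type*} {G : SimpleGraph V} {v w x : V}
    (hx : x ∈ branch G v w) : x = w ∨ ∃ u, G.Adj w u ∧ u ≠ v ∧ x ∈ branch G w u := by
  refine mem_of_reachable
    (S := {x | x = w ∨ ∃ u, G.Adj w u ∧ u ≠ v ∧ x ∈ branch G w u}) (Or.inl rfl) ?_ hx
  rintro a b - ha hab
  simp only [SimpleGraph.deleteEdges_adj, Set.mem_singleton_iff] at hab
  rcases ha with rfl | ⟨u, hwu, huv, ha⟩
  · refine Or.inr ⟨b, hab.1, ?_, mem_branch_self G _ _⟩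
    rintro rfl
    exact hab.2 Sym2.eq_swap
  · by_cases h : s(a, b) = s(w, u)
    · rcases Sym2.eq_iff.1 h with ⟨-, rfl⟩ | ⟨-, rfl⟩
      · exact Or.inr ⟨_, hwu, huv, mem_branch_self G _ _⟩
      · exact Or.inl rfl
    · exact Or.inr ⟨u, hwu, huv, branch_of_adj ha hab.1 h⟩

theorem notMem_branch {V : Type*} {G : SimpleGraph V} (hG : G.IsAcyclic) {w u : V}
    (h : G.Adj w u) : w ∉ branch G w u := by
  intro hw
  have := SimpleGraph.isAcyclic_iff_forall_isBridge.1 hG ((SimpleGraph.mem_edgeSet _).2 h)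
  rw [SimpleGraph.isBridge_iff] at this
  exact this (SimpleGraph.Reachable.symm hw)

theorem branch_ssubset {V : Type*} {G : SimpleGraph V} (hG : G.IsAcyclic) {v w u : V}
    (hwu : G.Adj w u) (huv : u ≠ v) : branch G w u ⊂ branch G v w := by
  refine (Set.ssubset_iff_of_subset ?_).2
    ⟨w, mem_branch_self G v w, notMem_branch hG hwu⟩
  intro x hx
  refine mem_of_reachable (S := branch G v w)
    (branch_of_adj (mem_branch_self G v w) hwu ?_) ?_ hx
  · intro h
    rcases Sym2.eq_iff.1 h with ⟨rfl, rfl⟩ | ⟨-, rfl⟩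
    · exact hwu.ne rfl
    · exact huv rfl
  · intro a b ha ha' hab
    refine branch_of_adj ha' ((G.deleteEdges_le _) hab) ?_
    intro h
    have hb : b ∈ branch G w u := SimpleGraph.Reachable.trans ha hab.reachable
    rcases Sym2.eq_iff.1 h with ⟨-, rfl⟩ | ⟨rfl, -⟩
    · exact notMem_branch hG hwu hb
    · exact notMem_branch hG hwu ha

/-- In a finite tree with all degrees `1` or `3`, some edge splits the leaves in a balanced way:
one of the two components contains between a third and two thirds of them. -/
theorem exists_balanced_branch {M : ℕ} {T : SimpleGraph (Fin M)} (hT : IsSubcubicTree T)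
    (L : Set (Fin M)) (hL : L = {v | deg T v = 1}) (h2 : 2 ≤ L.ncard) :
    ∃ v w, T.Adj v w ∧ L.ncard ≤ 3 * (branch T v w ∩ L).ncard ∧
      3 * (branch T v w ∩ L).ncard ≤ 2 * L.ncard := by
  obtain ⟨hT, hdeg⟩ := hT
  have hfin (S : Set (Fin M)) : S.Finite := S.toFinite
  have hex : ∃ p : Fin M × Fin M,
      T.Adj p.1 p.2 ∧ L.ncard ≤ 3 * (branch T p.1 p.2 ∩ L).ncard := by
    obtain ⟨v, hv⟩ : L.Nonempty := Set.nonempty_of_ncard_ne_zero (by omega)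
    have hv1 : (T.neighborSet v).ncard = 1 := by rw [hL] at hv; exact hv
    obtain ⟨w, hw⟩ : (T.neighborSet v).Nonempty :=
      Set.nonempty_of_ncard_ne_zero (by omega)
    have hvw : T.Adj v w := hw
    have hle : L.ncard ≤ (branch T v w ∩ L).ncard + (branch T w v ∩ L).ncard := by
      refine le_trans (Set.ncard_le_ncard (t := branch T v w ∩ L ∪ branch T w v ∩ L) ?_ (hfin _))
        (Set.ncard_union_le _ _)
      intro x hx
      rcases branch_union hT.connected v w x with h | h
      · exact Or.inl ⟨h, hx⟩
      · exact Or.inr ⟨h, hx⟩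
    by_cases h : L.ncard ≤ 3 * (branch T v w ∩ L).ncard
    · exact ⟨(v, w), hvw, h⟩
    · exact ⟨(w, v), hvw.symm, by dsimp only; omega⟩
  obtain ⟨⟨v, w⟩, ⟨hvw, hge⟩, hmin⟩ := Set.exists_min_image
    {p : Fin M × Fin M | T.Adj p.1 p.2 ∧ L.ncard ≤ 3 * (branch T p.1 p.2 ∩ L).ncard}
    (fun p => (branch T p.1 p.2).ncard) (Set.toFinite _) hex
  dsimp only at hvw hge hmin
  refine ⟨v, w, hvw, hge, ?_⟩
  by_contra! hlt
  have hmin' (u : Fin M) (hwu : T.Adj w u) (huv : u ≠ v) :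
      3 * (branch T w u ∩ L).ncard < L.ncard := by
    by_contra! h
    have h1 := hmin (w, u) ⟨hwu, h⟩
    have h2 := Set.ncard_lt_ncard (branch_ssubset hT.isAcyclic (v := v) hwu huv) (hfin _)
    dsimp only at h1
    omega
  rcases hdeg w with h1 | h3
  · have hsub : branch T v w ∩ L ⊆ {w} := by
      rintro x ⟨hx, -⟩
      rcases mem_branch_cases hx with rfl | ⟨u, hwu, huv, -⟩
      · rfl
      · exact absurd ((Set.ncard_le_one (hfin _)).1 h1.le u hwu v hvw.symm) huv
    have := Set.ncard_le_ncard hsub (hfin _)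
    rw [Set.ncard_singleton] at this
    omega
  · have hcard : (T.neighborSet w \ {v}).ncard = 2 := by
      have h3' : (T.neighborSet w).ncard = 3 := h3
      have := Set.ncard_sdiff_singleton_add_one (s := T.neighborSet w) (a := v) hvw.symm (hfin _)
      omega
    obtain ⟨a, b, -, hab⟩ := Set.ncard_eq_two.1 hcard
    have ha : a ∈ T.neighborSet w \ {v} := by rw [hab]; simp
    have hb : b ∈ T.neighborSet w \ {v} := by rw [hab]; simp
    have hsub : branch T v w ∩ L ⊆ branch T w a ∩ L ∪ branch T w b ∩ L := by
      rintro x ⟨hx, hxL⟩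
      rcases mem_branch_cases hx with rfl | ⟨u, hwu, huv, hxu⟩
      · rw [hL, Set.mem_ofPred_eq] at hxL
        omega
      · have hu : u ∈ T.neighborSet w \ {v} := ⟨hwu, huv⟩
        rw [hab] at hu
        rcases hu with rfl | rfl
        · exact Or.inl ⟨hxu, hxL⟩
        · exact Or.inr ⟨hxu, hxL⟩
    have := (Set.ncard_le_ncard hsub (hfin _)).trans (Set.ncard_union_le _ _)
    have := hmin' a ha.1 ha.2
    have := hmin' b hb.1 hb.2
    omega

/-- The caterpillar on `2 * k + 2` vertices: the odd vertices form the spine, vertex `0` is attached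
to `1`, and every odd vertex `i` is joined to `i + 1` and `i + 2`. -/
def caterpillar (k : ℕ) : SimpleGraph (Fin (2 * k + 2)) :=
  SimpleGraph.fromRel fun a b =>
    (a.val = 0 ∧ b.val = 1) ∨ (a.val % 2 = 1 ∧ (b.val = a.val + 1 ∨ b.val = a.val + 2))

theorem caterpillar_adj {k : ℕ} (a b : Fin (2 * k + 2)) :
    (caterpillar k).Adj a b ↔
      ((a.val = 0 ∧ b.val = 1) ∨ (a.val % 2 = 1 ∧ (b.val = a.val + 1 ∨ b.val = a.val + 2))) ∨
      ((b.val = 0 ∧ a.val = 1) ∨ (b.val % 2 = 1 ∧ (a.val = b.val + 1 ∨ a.val = b.val + 2))) := by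
  simp only [caterpillar, SimpleGraph.fromRel_adj, ne_eq, Fin.ext_iff, and_iff_right_iff_imp]
  omega

theorem deg_caterpillar {k : ℕ} (v : Fin (2 * k + 2)) :
    deg (caterpillar k) v = if v.val % 2 = 1 ∧ v.val < 2 * k + 1 then 3 else 1 := by
  unfold deg
  split_ifs with h
  · obtain ⟨p, hp⟩ : ∃ p : Fin (2 * k + 2), p.val = if v.val = 1 then 0 else v.val - 2 :=
      ⟨⟨if v.val = 1 then 0 else v.val - 2, by split_ifs <;> omega⟩, rfl⟩
    have hv : v.val + 2 < 2 * k + 2 := by omega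
    rw [Set.ncard_eq_three]
    refine ⟨p, ⟨v.val + 1, by omega⟩, ⟨v.val + 2, hv⟩, ?_, ?_, ?_, ?_⟩
    · rw [ne_eq, Fin.ext_iff]; split_ifs at hp <;> dsimp only <;> omega
    · rw [ne_eq, Fin.ext_iff]; split_ifs at hp <;> dsimp only <;> omega
    · rw [ne_eq, Fin.ext_iff]; dsimp only; omega
    · ext b
      simp only [SimpleGraph.mem_neighborSet, caterpillar_adj, Set.mem_insert_iff,
        Set.mem_singleton_iff, Fin.ext_iff]
      split_ifs at hp <;> omega
  · obtain ⟨p, hp⟩ : ∃ p : Fin (2 * k + 2), p.val =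
        if v.val = 0 then 1 else if v.val = 1 then 0 else
          if v.val % 2 = 0 then v.val - 1 else v.val - 2 :=
      ⟨⟨if v.val = 0 then 1 else if v.val = 1 then 0 else
          if v.val % 2 = 0 then v.val - 1 else v.val - 2, by split_ifs <;> omega⟩, rfl⟩
    rw [Set.ncard_eq_one]
    refine ⟨p, ?_⟩
    ext b
    simp only [SimpleGraph.mem_neighborSet, caterpillar_adj, Set.mem_singleton_iff, Fin.ext_iff]
    split_ifs at hp <;> omega

theorem caterpillar_connected (k : ℕ) : (caterpillar k).Connected := by
  rw [SimpleGraph.connected_iff_exists_forall_reachable]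
  refine ⟨⟨0, by omega⟩, fun v => ?_⟩
  obtain ⟨n, hn⟩ := v
  induction n using Nat.strong_induction_on with
  | _ n ih =>
    rcases Nat.eq_zero_or_pos n with rfl | hpos
    · exact SimpleGraph.Reachable.refl _
    · obtain ⟨p, hp⟩ : ∃ p, p = if n = 1 then 0 else if n % 2 = 0 then n - 1 else n - 2 :=
        ⟨_, rfl⟩
      have hlt : p < n := by split_ifs at hp <;> omega
      refine (ih p hlt (by omega)).trans (SimpleGraph.Adj.reachable ?_)
      rw [caterpillar_adj]
      dsimp only
      split_ifs at hp <;> omega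

theorem sum_deg_caterpillar (k : ℕ) : ∑ v, deg (caterpillar k) v = 4 * k + 2 := by
  have h (m : ℕ) : ∑ i ∈ Finset.range (2 * m + 1), (if i % 2 = 1 then 3 else 1) = 4 * m + 1 := by
    induction m with
    | zero => simp
    | succ m ih =>
      rw [show 2 * (m + 1) + 1 = 2 * m + 1 + 1 + 1 by ring, Finset.sum_range_succ,
        Finset.sum_range_succ, ih, if_pos (by omega), if_neg (by omega)]
      ring
  simp_rw [deg_caterpillar]
  rw [Fin.sum_univ_eq_sum_range
    (fun i => if i % 2 = 1 ∧ i < 2 * k + 1 then 3 else 1) (2 * k + 2), Finset.sum_range_succ,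
    if_neg (by omega), Finset.sum_congr rfl (g := fun i => if i % 2 = 1 then 3 else 1), h]
  intro i hi
  rw [Finset.mem_range] at hi
  simp [hi]

theorem deg_eq_degree {M : ℕ} (T : SimpleGraph (Fin M)) (v : Fin M) : deg T v = T.degree v := by
  rw [deg, Set.ncard_eq_toFinset_card', SimpleGraph.degree, SimpleGraph.neighborFinset]

theorem caterpillar_isSubcubicTree (k : ℕ) : IsSubcubicTree (caterpillar k) := by
  refine ⟨SimpleGraph.isTree_iff_connected_and_card.2 ⟨caterpillar_connected k, ?_⟩, fun v => ?_⟩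
  · have h := (caterpillar k).sum_degrees_eq_twice_card_edges
    simp_rw [← deg_eq_degree] at h
    rw [sum_deg_caterpillar] at h
    rw [Nat.card_eq_fintype_card, ← SimpleGraph.edgeFinset_card, Nat.card_eq_fintype_card,
      Fintype.card_fin]
    omega
  · rw [deg_caterpillar]
    split_ifs <;> simp

theorem card_leaves_caterpillar (k : ℕ) :
    Fintype.card {v // deg (caterpillar k) v = 1} = k + 2 := by
  have h := sum_deg_caterpillar k
  have h2 : ∀ v, deg (caterpillar k) v + (if deg (caterpillar k) v = 1 then 2 else 0) = 3 := by
    intro v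
    rcases (caterpillar_isSubcubicTree k).2 v with h | h <;> simp [h]
  have h3 := Finset.sum_congr rfl (fun v (_ : v ∈ Finset.univ) => h2 v)
  rw [Finset.sum_add_distrib, h, ← Finset.sum_filter, Finset.sum_const, Finset.sum_const,
    Finset.card_univ, Fintype.card_fin] at h3
  rw [Fintype.card_subtype]
  simp only [smul_eq_mul] at h3
  omega

/-- A finite type with at least two elements labels the leaves of some subcubic tree. -/
theorem exists_subcubicTree (V : Type) [Fintype V] (h : 2 ≤ Fintype.card V) :
    ∃ (M : ℕ) (T : SimpleGraph (Fin M)), IsSubcubicTree T ∧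
      Nonempty ({v : Fin M // deg T v = 1} ≃ V) := by
  refine ⟨_, caterpillar (Fintype.card V - 2), caterpillar_isSubcubicTree _,
    ⟨Fintype.equivOfCardEq ?_⟩⟩
  rw [card_leaves_caterpillar]
  omega

/-- `G` has at least `k` edges `a i – b i` across the cut `(A, Aᶜ)` such that, in a suitable order,
the bipartite adjacency matrix between the `a i` and the `b j` is unitriangular. -/
def HasTriangularCut {V : Type} (G : SimpleGraph V) (A : Set V) (k : ℕ) : Prop :=
  ∃ (ι : Type) (_ : Fintype ι) (a b : ι → V) (f : ι → ℤ), k ≤ Fintype.card ι ∧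
    (∀ i, a i ∈ A ∧ b i ∉ A ∧ G.Adj (a i) (b i)) ∧
    ∀ i j, G.Adj (a i) (b j) → i ≠ j → f j < f i

theorem HasTriangularCut.of_compl {V : Type} {G : SimpleGraph V} {A : Set V} {k : ℕ}
    (h : HasTriangularCut G Aᶜ k) : HasTriangularCut G A k := by
  obtain ⟨ι, _, a, b, f, hk, hab, hf⟩ := h
  refine ⟨ι, ‹_›, b, a, fun i => - f i, hk, fun i => ?_, fun i j hij hne => ?_⟩
  · obtain ⟨h1, h2, h3⟩ := hab i
    exact ⟨not_not.1 h2, h1, h3.symm⟩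
  · have := hf j i hij.symm hne.symm
    dsimp only
    omega

theorem gridGraph_adj {d : ℕ} (a b : Fin d × Fin d) : (gridGraph d).Adj a b ↔
    (a.1 = b.1 ∧ (a.2.val + 1 = b.2.val ∨ b.2.val + 1 = a.2.val)) ∨
    (a.2 = b.2 ∧ (a.1.val + 1 = b.1.val ∨ b.1.val + 1 = a.1.val)) := by
  simp only [gridGraph, SimpleGraph.fromRel_adj, ne_eq, Prod.ext_iff, Fin.ext_iff]
  omega

theorem HasTriangularCut.of_swap {d k : ℕ} {A : Set (Fin d × Fin d)}
    (h : HasTriangularCut (gridGraph d) (Prod.swap ⁻¹' A) k) :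
    HasTriangularCut (gridGraph d) A k := by
  have hadj (p q : Fin d × Fin d) :
      (gridGraph d).Adj p.swap q.swap ↔ (gridGraph d).Adj p q := by
    simp only [gridGraph_adj, Prod.fst_swap, Prod.snd_swap]
    tauto
  obtain ⟨ι, _, a, b, f, hk, hab, hf⟩ := h
  refine ⟨ι, ‹_›, fun i => (a i).swap, fun i => (b i).swap, f, hk, fun i => ?_,
    fun i j hij hne => hf i j ((hadj _ _).1 hij) hne⟩
  obtain ⟨h1, h2, h3⟩ := hab i
  exact ⟨h1, h2, (hadj _ _).2 h3⟩

/-- Walking from a point of `P` towards the nearest point outside `P`, the last step leaves `P`. -/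
theorem exists_last_step {d : ℕ} {P : Fin d → Prop} {c y₀ : Fin d} (hc : P c) (hy₀ : ¬ P y₀) :
    ∃ x y : Fin d, P x ∧ ¬ P y ∧ (x.val + 1 = y.val ∨ y.val + 1 = x.val) ∧
      |(x.val : ℤ) - c.val| + 1 = |(y.val : ℤ) - c.val| := by
  obtain ⟨y, hy, hmin⟩ := Set.exists_min_image {y | ¬ P y}
    (fun y : Fin d => |(y.val : ℤ) - c.val|) (Set.toFinite _) ⟨y₀, hy₀⟩
  have hyc : y.val ≠ c.val := fun h => hy (Fin.ext h ▸ hc)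
  have hyd := y.isLt
  have key (x : Fin d) (h : |(x.val : ℤ) - c.val| + 1 = |(y.val : ℤ) - c.val|) : P x := by
    by_contra hx
    have := hmin x hx
    omega
  rcases lt_or_gt_of_ne hyc with h | h
  · have h' : |((y.val + 1 : ℕ) : ℤ) - c.val| + 1 = |(y.val : ℤ) - c.val| := by
      rw [abs_of_nonpos (by omega), abs_of_nonpos (by omega)]
      omega
    exact ⟨⟨y.val + 1, by omega⟩, y, key _ h', hy, Or.inr rfl, h'⟩
  · have h' : |((y.val - 1 : ℕ) : ℤ) - c.val| + 1 = |(y.val : ℤ) - c.val| := by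
      rw [abs_of_nonneg (by omega), abs_of_nonneg (by omega)]
      omega
    exact ⟨⟨y.val - 1, by omega⟩, y, key _ h', hy, Or.inl (by dsimp only; omega), h'⟩

/-- If a whole column lies in `A`, then every row meeting `Aᶜ` contributes to the cut. -/
theorem hasTriangularCut_of_column {d : ℕ} {A : Set (Fin d × Fin d)} {c : Fin d}
    (hc : ∀ r, (r, c) ∈ A) :
    HasTriangularCut (gridGraph d) A (Fintype.card {r : Fin d // ∃ y, (r, y) ∉ A}) := by
  have h (r : {r : Fin d // ∃ y, (r, y) ∉ A}) :=
    exists_last_step (P := fun x => (r.1, x) ∈ A) (hc r.1) r.2.choose_spec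
  choose x y hx hy hxy hd using h
  refine ⟨_, inferInstance, fun r => (r.1, x r), fun r => (r.1, y r),
    fun r => |((y r).val : ℤ) - c.val|, le_rfl, fun r => ⟨hx r, hy r, ?_⟩, fun r s hrs hne => ?_⟩
  · rw [gridGraph_adj]
    exact Or.inl ⟨rfl, hxy r⟩
  · rw [gridGraph_adj] at hrs
    rcases hrs with ⟨h, -⟩ | ⟨h, -⟩
    · exact absurd (Subtype.ext h) hne
    · dsimp only at h ⊢
      rw [← h, ← hd r]
      omega

/-- If every row meets both `A` and `Aᶜ`, then every other row contributes to the cut. -/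
theorem hasTriangularCut_of_rows {l : ℕ} {A : Set (Fin (2 * l + 1) × Fin (2 * l + 1))}
    (h₁ : ∀ r, ∃ y, (r, y) ∈ A) (h₂ : ∀ r, ∃ y, (r, y) ∉ A) :
    HasTriangularCut (gridGraph (2 * l + 1)) A (l + 1) := by
  have h (r : Fin (2 * l + 1)) :=
    exists_last_step (P := fun x => (r, x) ∈ A) (h₁ r).choose_spec (h₂ r).choose_spec
  choose x y hx hy hxy _ using h
  let R (i : Fin (l + 1)) : Fin (2 * l + 1) := ⟨2 * i.val, by omega⟩
  refine ⟨Fin (l + 1), inferInstance, fun i => (R i, x (R i)), fun i => (R i, y (R i)),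
    fun _ => 0, by simp, fun i => ⟨hx _, hy _, ?_⟩, fun i j hij hne => ?_⟩
  · rw [gridGraph_adj]
    exact Or.inl ⟨rfl, hxy _⟩
  · exfalso
    rw [gridGraph_adj] at hij
    rw [ne_eq, Fin.ext_iff] at hne
    simp only [R, Fin.ext_iff] at hij
    omega

theorem hasTriangularCut_of_cross {d k : ℕ} {A : Set (Fin d × Fin d)} {r c : Fin d}
    (hr : ∀ y, (r, y) ∈ A) (hc : ∀ x, (x, c) ∈ A) (hA : k * k < Aᶜ.ncard) :
    HasTriangularCut (gridGraph d) A (k + 1) := by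
  have hrow := hasTriangularCut_of_column hc
  have hcol := (hasTriangularCut_of_column (A := Prod.swap ⁻¹' A) hr).of_swap
  set p := Fintype.card {r : Fin d // ∃ y, (r, y) ∉ A} with hp
  set q := Fintype.card {c : Fin d // ∃ x, (c, x) ∉ Prod.swap ⁻¹' A} with hq
  have hle : Aᶜ.ncard ≤ p * q := by
    rw [hp, hq, ← Fintype.card_prod, ← Nat.card_eq_fintype_card, ← Nat.card_coe_set_eq]
    refine Nat.card_le_card_of_injective
      (fun z : ↥Aᶜ => (⟨⟨z.1.1, z.1.2, z.2⟩, ⟨z.1.2, z.1.1, z.2⟩⟩ :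
        {r : Fin d // ∃ y, (r, y) ∉ A} × {c : Fin d // ∃ x, (c, x) ∉ Prod.swap ⁻¹' A})) ?_
    intro z w hzw
    simp only [Prod.mk.injEq, Subtype.mk.injEq] at hzw
    exact Subtype.ext (Prod.ext hzw.1 hzw.2)
  have mono {m : ℕ} (hm : k + 1 ≤ m) (h : HasTriangularCut (gridGraph d) A m) :
      HasTriangularCut (gridGraph d) A (k + 1) := by
    obtain ⟨ι, i, a, b, f, hk, h⟩ := h
    exact ⟨ι, i, a, b, f, hm.trans hk, h⟩
  by_cases hpk : k + 1 ≤ p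
  · exact mono hpk hrow
  · refine mono ?_ hcol
    by_contra! hqk
    have := Nat.mul_le_mul (show p ≤ k by omega) (show q ≤ k by omega)
    omega

/-- Both sides of the cut having more than `k²` vertices forces a large triangular cut. -/
theorem hasTriangularCut_grid {l k : ℕ} {A : Set (Fin (2 * l + 1) × Fin (2 * l + 1))}
    (hkl : k ≤ l) (h₁ : k * k < A.ncard) (h₂ : k * k < Aᶜ.ncard) :
    HasTriangularCut (gridGraph (2 * l + 1)) A (k + 1) := by
  have mono (h : HasTriangularCut (gridGraph (2 * l + 1)) A (l + 1)) :
      HasTriangularCut (gridGraph (2 * l + 1)) A (k + 1) := by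
    obtain ⟨ι, i, a, b, f, hk, h⟩ := h
    exact ⟨ι, i, a, b, f, by omega, h⟩
  by_cases hrows : ∀ r, (∃ y, (r, y) ∈ A) ∧ ∃ y, (r, y) ∉ A
  · exact mono (hasTriangularCut_of_rows (fun r => (hrows r).1) fun r => (hrows r).2)
  by_cases hcols : ∀ c, (∃ x, (x, c) ∈ A) ∧ ∃ x, (x, c) ∉ A
  · exact mono (hasTriangularCut_of_rows (A := Prod.swap ⁻¹' A) (fun c => (hcols c).1)
      fun c => (hcols c).2).of_swap
  push Not at hrows hcols
  obtain ⟨r, hr⟩ := hrows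
  obtain ⟨c, hc⟩ := hcols
  by_cases hrc : (r, c) ∈ A
  · exact hasTriangularCut_of_cross (hr ⟨c, hrc⟩) (hc ⟨r, hrc⟩) h₂
  · refine (hasTriangularCut_of_cross (A := Aᶜ) (r := r) (c := c) (fun y hy => ?_)
      (fun x hx => ?_) (by rwa [compl_compl])).of_compl
    · exact hrc (hr ⟨y, hy⟩ c)
    · exact hrc (hc ⟨x, hx⟩ r)

theorem two_mul_qCount {V : Type} [Fintype V] [DecidableEq V] (G : SimpleGraph V)
    (x : V → Bool) :
    2 * qCount G x = ∑ p, ∑ q, if G.Adj p q ∧ x p = true ∧ x q = true then 1 else 0 := by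
  let H : SimpleGraph V :=
    { Adj := fun p q => G.Adj p q ∧ x p = true ∧ x q = true
      symm := ⟨fun p q h => ⟨h.1.symm, h.2.2, h.2.1⟩⟩
      loopless := ⟨fun p h => G.loopless.irrefl p h.1⟩ }
  have hq : qCount G x = H.edgeFinset.card := by
    unfold qCount
    congr 1
    ext e
    induction e with
    | _ p q => simp [H]
  rw [hq, ← SimpleGraph.sum_degrees_eq_twice_card_edges]
  refine Finset.sum_congr rfl fun p _ => ?_
  rw [← Finset.sum_filter, Finset.sum_const, smul_eq_mul, mul_one, SimpleGraph.degree]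
  congr 1
  ext q
  simp [H]

/-- The string agreeing with `u` on `A` and with `v` on `Aᶜ`. -/
def glue {V : Type} (A : Set V) (u : ↥A → Bool) (v : ↥Aᶜ → Bool) : V → Bool :=
  fun i => if h : i ∈ A then u ⟨i, h⟩ else v ⟨i, h⟩

theorem qCount_glue {V : Type} [Fintype V] [DecidableEq V] (G : SimpleGraph V) (A : Set V)
    (u : ↥A → Bool) (v : ↥Aᶜ → Bool) :
    qCount G (glue A u v) = qCount G (glue A u fun _ => false) +
      qCount G (glue A (fun _ => false) v) +
      ∑ q : ↥Aᶜ, ∑ p : ↥A, if G.Adj p q ∧ u p = true ∧ v q = true then 1 else 0 := by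
  have split (F : V → V → ℕ) : ∑ p, ∑ q, F p q =
      (∑ p : ↥A, ∑ q : ↥A, F p q) + (∑ p : ↥Aᶜ, ∑ q : ↥Aᶜ, F p q) +
      ((∑ p : ↥A, ∑ q : ↥Aᶜ, F p q) + ∑ p : ↥Aᶜ, ∑ q : ↥A, F p q) := by
    have h (f : V → ℕ) : ∑ p, f p = ∑ p : ↥A, f p + ∑ p : ↥Aᶜ, f p :=
      (Fintype.sum_subtype_add_sum_subtype (fun p => p ∈ A) f).symm
    simp_rw [h, Finset.sum_add_distrib]
    ring
  have hA (u : ↥A → Bool) (v : ↥Aᶜ → Bool) (p : ↥A) : glue A u v p = u p := by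
    simp [glue]
  have hA' (u : ↥A → Bool) (v : ↥Aᶜ → Bool) (p : ↥Aᶜ) : glue A u v p = v p := by
    have := p.2
    simp only [Set.mem_compl_iff] at this
    simp [glue, this]
  have hcross : ∑ p : ↥Aᶜ, ∑ q : ↥A, (if G.Adj p q ∧ v p = true ∧ u q = true then 1 else 0) =
      ∑ q : ↥Aᶜ, ∑ p : ↥A, if G.Adj p q ∧ u p = true ∧ v q = true then 1 else 0 := by
    refine Finset.sum_congr rfl fun p _ => Finset.sum_congr rfl fun q _ => ?_
    simp only [G.adj_comm p q, and_comm (a := v p = true)]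
  have h1 := two_mul_qCount G (glue A u v)
  have h2 := two_mul_qCount G (glue A u fun _ => false)
  have h3 := two_mul_qCount G (glue A (fun _ => false) v)
  rw [split] at h1 h2 h3
  simp only [hA, hA', Bool.false_eq_true, and_false, false_and, if_false,
    Finset.sum_const_zero, add_zero, zero_add] at h1 h2 h3
  rw [Finset.sum_comm (s := (Finset.univ : Finset ↥A)) (t := (Finset.univ : Finset ↥Aᶜ)),
    hcross] at h1
  omega

/-- The parity of the number of neighbors in `{p ∈ A | u p}` of a vertex outside `A`. -/
def parity {V : Type} [Fintype V] (G : SimpleGraph V) (A : Set V) (u : ↥A → Bool)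
    (q : ↥Aᶜ) : ZMod 2 :=
  ∑ p : ↥A, if G.Adj p q ∧ u p = true then 1 else 0

/-- The additive character `w ↦ (-1) ^ (n ⬝ w)`. -/
def signChar {κ : Type} [Fintype κ] (n : κ → ZMod 2) : AddChar (κ → ZMod 2) ℂ :=
  (AddChar.zmodChar 2 (show (-1 : ℂ) ^ 2 = 1 by norm_num)).compAddMonoidHom
    { toFun := fun w => ∑ q, n q * w q
      map_zero' := by simp
      map_add' := fun w w' => by simp [mul_add, Finset.sum_add_distrib] }

theorem signChar_apply {κ : Type} [Fintype κ] (n w : κ → ZMod 2) :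
    signChar n w = (-1 : ℂ) ^ (∑ q, n q * w q).val := rfl

theorem signChar_injective {κ : Type} [Fintype κ] :
    Function.Injective (signChar : (κ → ZMod 2) → AddChar (κ → ZMod 2) ℂ) := by
  intro n m h
  funext q
  have h' := DFunLike.congr_fun h (Pi.single q 1)
  simp only [signChar_apply, Pi.single_apply, mul_ite, mul_one, mul_zero,
    Finset.sum_ite_eq', Finset.mem_univ, if_true] at h'
  generalize n q = a at h' ⊢
  generalize m q = b at h' ⊢
  fin_cases a <;> fin_cases b <;> first | rfl | (exfalso; revert h'; simp [ZMod.val]; try norm_num)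

theorem graphState_glue {V : Type} [Fintype V] [DecidableEq V] (G : SimpleGraph V) (A : Set V)
    (u : ↥A → Bool) (w : ↥Aᶜ → ZMod 2) :
    graphState G (glue A u fun q => decide (w q = 1)) =
      (-1) ^ qCount G (glue A u fun _ => false) *
      graphState G (glue A (fun _ => false) fun q => decide (w q = 1)) *
      signChar (parity G A u) w := by
  have hχ : signChar (parity G A u) w = (-1 : ℂ) ^ (∑ q : ↥Aᶜ, ∑ p : ↥A,
      if G.Adj p q ∧ u p = true ∧ decide (w q = 1) = true then 1 else 0) := by
    rw [← AddChar.zmodChar_apply' (show (-1 : ℂ) ^ 2 = 1 by norm_num)]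
    refine congrArg (AddChar.zmodChar 2 _) ?_
    simp only [AddMonoidHom.coe_mk, ZeroHom.coe_mk, parity]
    push_cast
    refine Finset.sum_congr rfl fun q _ => ?_
    rw [Finset.sum_mul]
    refine Finset.sum_congr rfl fun p _ => ?_
    have : w q = 0 ∨ w q = 1 := by
      generalize w q = a
      fin_cases a
      · exact Or.inl rfl
      · exact Or.inr rfl
    rcases this with h | h <;> simp [h]
  rw [hχ]
  unfold graphState
  rw [qCount_glue, pow_add, pow_add]
  ring

/-- The Schmidt rank is at least the number of distinct neighborhood parities. -/
theorem card_le_schmidtRank {V : Type} [Fintype V] [DecidableEq V] (G : SimpleGraph V) (A : Set V)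
    {σ : Type} [Fintype σ] (U : σ → ↥A → Bool)
    (hU : Function.Injective fun s => parity G A (U s)) :
    Fintype.card σ ≤ schmidtRank (graphState G) A := by
  let v : (↥Aᶜ → ZMod 2) → ↥Aᶜ → Bool := fun w q => decide (w q = 1)
  let N : Matrix σ (↥Aᶜ → ZMod 2) ℂ := Matrix.of fun s w => graphState G (glue A (U s) (v w))
  have hN : N.rank ≤ schmidtRank (graphState G) A :=
    Matrix.rank_submatrix_le (Matrix.of fun (u : ↥A → Bool) (v : ↥Aᶜ → Bool) =>
      graphState G (glue A u v)) U v
  rw [← LinearIndependent.rank_matrix (M := N)]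
  · exact hN
  have hχ := (AddChar.linearIndependent (↥Aᶜ → ZMod 2) ℂ).comp
    (fun s => signChar (parity G A (U s))) (signChar_injective.comp hU)
  rw [Fintype.linearIndependent_iff] at hχ ⊢
  intro g hg s
  have hzero := hχ (fun s => g s * (-1) ^ qCount G (glue A (U s) fun _ => false)) ?_ s
  · exact (mul_eq_zero.1 hzero).resolve_right (pow_ne_zero _ (by norm_num))
  · funext w
    have hw := congrFun hg w
    simp only [Finset.sum_apply, Pi.smul_apply, smul_eq_mul, Pi.zero_apply, N, Matrix.row,
      Matrix.of_apply, v, fun s => graphState_glue G A (U s) w, Function.comp_apply] at hw ⊢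
    have hne : graphState G (glue A (fun _ => false) fun q => decide (w q = 1)) ≠ 0 := by
      unfold graphState
      refine mul_ne_zero (one_div_ne_zero ?_) (pow_ne_zero _ (by norm_num))
      rw [ne_eq, Complex.ofReal_eq_zero]
      positivity
    refine (mul_eq_zero.1 ?_).resolve_left hne
    rw [← hw, Finset.mul_sum]
    exact Finset.sum_congr rfl fun s _ => by ring

theorem two_pow_le_schmidtRank {V : Type} [Fintype V] [DecidableEq V] {G : SimpleGraph V}
    {A : Set V} {k : ℕ} (h : HasTriangularCut G A k) :
    2 ^ k ≤ schmidtRank (graphState G) A := by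
  obtain ⟨ι, _, a, b, f, hk, hab, hf⟩ := h
  have ha : Function.Injective a := by
    intro i j hij
    by_contra hne
    have h1 := hf i j (hij ▸ (hab j).2.2) hne
    have h2 := hf j i (hij ▸ (hab i).2.2) (Ne.symm hne)
    omega
  let U (s : Finset ι) (p : ↥A) : Bool := decide (∃ i ∈ s, a i = p)
  have hpar (s : Finset ι) (q : ↥Aᶜ) :
      parity G A (U s) q = ∑ i, if G.Adj (a i) q ∧ i ∈ s then 1 else 0 := by
    unfold parity
    refine (Finset.sum_of_injOn (fun i => (⟨a i, (hab i).1⟩ : ↥A))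
      (fun i _ j _ hij => ha (congrArg Subtype.val hij)) (fun _ _ => Finset.mem_coe.2
        (Finset.mem_univ _)) (fun p _ hp => if_neg ?_) fun i _ => ?_).symm
    · rintro ⟨-, hs⟩
      obtain ⟨i, -, hi⟩ := of_decide_eq_true hs
      exact hp ⟨i, by simp, Subtype.ext hi⟩
    · simp [U, ha.eq_iff]
  refine (Nat.pow_le_pow_right two_pos hk).trans ?_
  rw [← Fintype.card_finset]
  refine card_le_schmidtRank G A U fun s t hst => ?_
  by_contra hne
  obtain ⟨i, hi, hmax⟩ := Finset.exists_max_image (symmDiff s t) f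
    (Finset.nonempty_iff_ne_empty.2 fun h => hne (symmDiff_eq_bot.1 h))
  have h := congrFun hst ⟨b i, (hab i).2.1⟩
  simp only [hpar] at h
  rw [← Finset.add_sum_erase _ _ (Finset.mem_univ i),
    ← Finset.add_sum_erase _ _ (Finset.mem_univ i)] at h
  have hrest : ∑ j ∈ Finset.univ.erase i, (if G.Adj (a j) (b i) ∧ j ∈ s then (1 : ZMod 2) else 0) =
      ∑ j ∈ Finset.univ.erase i, if G.Adj (a j) (b i) ∧ j ∈ t then 1 else 0 := by
    refine Finset.sum_congr rfl fun j hj => ?_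
    by_cases hadj : G.Adj (a j) (b i)
    · have hlt := hf j i hadj (Finset.ne_of_mem_erase hj)
      have hj' : j ∉ symmDiff s t := fun h => absurd (hmax j h) (by omega)
      have : j ∈ s ↔ j ∈ t := by
        rw [Finset.mem_symmDiff] at hj'
        tauto
      simp only [this]
    · simp [hadj]
  rw [hrest, add_left_inj] at h
  rw [Finset.mem_symmDiff] at hi
  rcases hi with ⟨h1, h2⟩ | ⟨h1, h2⟩ <;> simp [h1, h2, (hab i).2.2] at h

theorem ncard_leafSide {M : ℕ} (T : SimpleGraph (Fin M)) {V : Type}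
    (ℓ : {v : Fin M // deg T v = 1} ≃ V) (v w : Fin M) :
    (leafSide T ℓ s(v, w) w).ncard = (branch T v w ∩ {x | deg T x = 1}).ncard := by
  have h1 : leafSide T ℓ s(v, w) w = ℓ '' (Subtype.val ⁻¹' branch T v w) := rfl
  rw [h1, Set.ncard_image_of_injective _ ℓ.injective,
    ← Set.ncard_image_of_injective _ Subtype.val_injective]
  congr 1
  ext x
  simp [and_comm]

theorem exists_edge_schmidtRank {l : ℕ} (hl : 2 ≤ l) {M : ℕ} {T : SimpleGraph (Fin M)}
    (hT : IsSubcubicTree T)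
    (ℓ : {v : Fin M // deg T v = 1} ≃ Fin (2 * l + 1) × Fin (2 * l + 1)) :
    ∃ e ∈ T.edgeSet, ∃ w ∈ e,
      2 ^ (l - 1) ≤ schmidtRank (clusterState (2 * l + 1)) (leafSide T ℓ e w) := by
  have hn : {v | deg T v = 1}.ncard = (2 * l + 1) * (2 * l + 1) := by
    rw [← Nat.card_coe_set_eq]
    refine (Nat.card_congr ℓ).trans ?_
    simp
  obtain ⟨k, rfl⟩ := Nat.exists_eq_add_of_le' hl
  obtain ⟨v, w, hvw, h1, h2⟩ := exists_balanced_branch hT _ rfl (by rw [hn]; nlinarith)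
  refine ⟨s(v, w), hvw, w, Sym2.mem_mk_right v w, ?_⟩
  rw [← ncard_leafSide T ℓ, hn] at h1 h2
  have h3 := Set.ncard_add_ncard_compl (leafSide T ℓ s(v, w) w)
  rw [Nat.card_prod, Nat.card_fin] at h3
  exact two_pow_le_schmidtRank (hasTriangularCut_grid (k := k) (by omega) (by nlinarith)
    (by nlinarith))

theorem le_chiWidth_clusterState {l : ℕ} (hl : 2 ≤ l) :
    (l : ℝ) - 1 ≤ chiWidth (clusterState (2 * l + 1)) := by
  refine le_csInf ?_ ?_
  · obtain ⟨M, T, hT, ⟨ℓ⟩⟩ := exists_subcubicTree (Fin (2 * l + 1) × Fin (2 * l + 1))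
      (by rw [Fintype.card_prod, Fintype.card_fin]; nlinarith)
    exact ⟨_, M, T, hT, ℓ, rfl⟩
  · rintro r ⟨M, T, hT, ℓ, rfl⟩
    obtain ⟨e, he, w, hw, hr⟩ := exists_edge_schmidtRank hl hT ℓ
    have hbdd : BddAbove { s : ℝ | ∃ e ∈ T.edgeSet, ∃ w, w ∈ e ∧
        s = Real.logb 2 (schmidtRank (clusterState (2 * l + 1)) (leafSide T ℓ e w)) } := by
      refine ((Set.finite_range fun p : Sym2 (Fin M) × Fin M => Real.logb 2
        (schmidtRank (clusterState (2 * l + 1)) (leafSide T ℓ p.1 p.2))).subset ?_).bddAbove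
      rintro s ⟨e, -, w, -, rfl⟩
      exact ⟨(e, w), rfl⟩
    refine le_trans ?_ (le_csSup hbdd ⟨e, he, w, hw, rfl⟩)
    have hr' : ((2 : ℝ) ^ (l - 1)) ≤
        (schmidtRank (clusterState (2 * l + 1)) (leafSide T ℓ e w) : ℝ) := by exact_mod_cast hr
    have h := Real.logb_le_logb_of_le one_lt_two (by positivity) hr'
    rw [← Real.rpow_natCast, Real.logb_rpow two_pos (by norm_num)] at h
    rwa [Nat.cast_sub (by omega), Nat.cast_one] at h

/-- For every `l ≥ 2`, the Schmidt-rank width of the 2D cluster state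
`C_{(2l+1)×(2l+1)}` is at least `l − 1`.  In particular, the Schmidt-rank width is
unbounded on the family of 2D cluster states. -/
theorem chiWidth_clusterState_lower_bound :
    (∀ l : ℕ, 2 ≤ l → (l : ℝ) - 1 ≤ chiWidth (clusterState (2 * l + 1))) ∧
    (∀ c : ℝ, ∃ d : ℕ, c < chiWidth (clusterState d)) := by
  refine ⟨fun l hl => le_chiWidth_clusterState hl, fun c => ?_⟩
  obtain ⟨n, hn⟩ := exists_nat_gt c
  refine ⟨2 * (n + 2) + 1, hn.trans_le (le_trans ?_ (le_chiWidth_clusterState (by omega)))⟩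
  push_cast
  linarith
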